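/- arXiv:2002.11234 — 3 statements merged into one kernel-verified Lean document; each statement's English description precedes it below -/
import Mathlib

section
/- With ℓ = d/N and s = 1 − 1/N, for every threshold angle θ₀ with 0 < θ₀ ≤ π/2 and every integer t ≥ 0, √( Σ_{k : θ₀ < θ_k ≤ π} α_k² · |e^{i t θ_k} − e^{i t θ̂_k}|² ) ≤ 2/√((1 − cos θ₀)·(N − 1)). -/
open scoped BigOperators ComplexConjugate
open Complex

set_option linter.unusedSectionVars false

noncomputable section

namespace LQWPaper

variable {V : Type*} [Fintype V] [DecidableEq V]

/-- The inner product `⟨v,w⟩ = Σᵢ conj (v i) * w i` on `ι → ℂ`. -/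
def cip {ι : Type*} [Fintype ι] (v w : ι → ℂ) : ℂ :=
  ∑ i, (starRingEnd ℂ) (v i) * w i

/-- The `ℓ₂`-norm on `ι → ℂ`. -/
def l2norm {ι : Type*} [Fintype ι] (v : ι → ℂ) : ℝ :=
  Real.sqrt (∑ i, Complex.normSq (v i))

/-- The operator norm (with respect to the `ℓ₂`-norm) of a square matrix. -/
def opNorm {ι : Type*} [Fintype ι] (M : Matrix ι ι ℂ) : ℝ :=
  sSup {r : ℝ | ∃ v : ι → ℂ, l2norm v = 1 ∧ r = l2norm (M.mulVec v)}

/-- A fixed labeling `y_1(x), …, y_d(x)` of the `d` neighbors of each vertex of a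
`d`-regular graph: a bijection from `Fin d` to the neighbor set of each vertex. -/
structure Labeling (G : SimpleGraph V) (d : ℕ) where
  nbr : (x : V) → Fin d ≃ (G.neighborSet x)

lemma Labeling.adj {G : SimpleGraph V} {d : ℕ} (L : Labeling G d) (x : V) (i : Fin d) :
    G.Adj x (L.nbr x i) := (L.nbr x i).prop

/-- The (unique) index of `x` among the neighbors of `y`. -/
def Labeling.idx {G : SimpleGraph V} {d : ℕ} (L : Labeling G d) (y x : V)
    (h : G.Adj y x) : Fin d := (L.nbr y).symm ⟨x, h⟩

/-- The flip-flop shift on basis states: `|x, e_i⟩ ↦ |y, e_j⟩` where `y = y_i(x)` and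
`x = y_j(y)`, and `|x, ↻⟩ ↦ |x, ↻⟩`.  The self-loop is the coin index `Fin.last d`. -/
def shiftFun {G : SimpleGraph V} {d : ℕ} (L : Labeling G d)
    (p : V × Fin (d + 1)) : V × Fin (d + 1) :=
  if h : p.2 = Fin.last d then p
  else
    let i : Fin d := p.2.castPred h
    ⟨L.nbr p.1 i, Fin.castSucc (L.idx (L.nbr p.1 i) p.1 ((L.adj p.1 i).symm))⟩

/-- The flip-flop shift operator `S` as a matrix. -/
def shiftMat {G : SimpleGraph V} {d : ℕ} (L : Labeling G d) :
    Matrix (V × Fin (d + 1)) (V × Fin (d + 1)) ℂ :=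
  Matrix.of fun p q => if p = shiftFun L q then 1 else 0

/-- The coin state `|c⟩ = (1/√(d+ℓ)) (|e_1⟩ + ⋯ + |e_d⟩ + √ℓ |↻⟩)`. -/
def coinVec (d : ℕ) (ℓ : ℝ) : Fin (d + 1) → ℂ :=
  fun a => if a = Fin.last d then ((Real.sqrt ℓ / Real.sqrt (d + ℓ) : ℝ) : ℂ)
           else ((1 / Real.sqrt (d + ℓ) : ℝ) : ℂ)

/-- The coin operator `C = 2|c⟩⟨c| − I`. -/
def coinMat (d : ℕ) (ℓ : ℝ) : Matrix (Fin (d + 1)) (Fin (d + 1)) ℂ :=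
  (2 : ℂ) • Matrix.of (fun a b => coinVec d ℓ a * (starRingEnd ℂ) (coinVec d ℓ b)) - 1

/-- The global coin operator `I_N ⊗ C`. -/
def coinLift (d : ℕ) (ℓ : ℝ) :
    Matrix (V × Fin (d + 1)) (V × Fin (d + 1)) ℂ :=
  Matrix.of fun p q => if p.1 = q.1 then coinMat d ℓ p.2 q.2 else 0

/-- The oracle `G_or = (I_N − 2|m⟩⟨m|) ⊗ I_{d+1}`. -/
def oracleMat (d : ℕ) (m : V) : Matrix (V × Fin (d + 1)) (V × Fin (d + 1)) ℂ :=
  Matrix.of fun p q => if p = q then (if p.1 = m then -1 else 1) else 0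

/-- The lackadaisical quantum walk `U_lazy = S · (I_N ⊗ C) · G_or`. -/
def Ulazy {G : SimpleGraph V} {d : ℕ} (L : Labeling G d) (m : V) (ℓ : ℝ) :
    Matrix (V × Fin (d + 1)) (V × Fin (d + 1)) ℂ :=
  shiftMat L * coinLift d ℓ * oracleMat d m

/-- The initial state `|init_lazy⟩ = (1/√(N−1)) Σ_{x ≠ m} |x⟩ ⊗ |c⟩`. -/
def initLazy (m : V) (d : ℕ) (ℓ : ℝ) : V × Fin (d + 1) → ℂ :=
  fun p => if p.1 = m then 0
    else ((1 / Real.sqrt ((Fintype.card V : ℝ) - 1) : ℝ) : ℂ) * coinVec d ℓ p.2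

/-- The state `|⇒⟩ = (1/√d)(|e_1⟩ + ⋯ + |e_d⟩)`. -/
def plusVec (d : ℕ) : Fin (d + 1) → ℂ :=
  fun a => if a = Fin.last d then 0 else ((1 / Real.sqrt d : ℝ) : ℂ)

/-- The modified oracle `Ĝ_or = I − 2(|m,↻⟩⟨m,↻| + |m,⇒⟩⟨m,⇒|)`. -/
def oracleHat (d : ℕ) (m : V) : Matrix (V × Fin (d + 1)) (V × Fin (d + 1)) ℂ :=
  1 - (2 : ℂ) • Matrix.of (fun p q =>
    (if p = (m, Fin.last d) ∧ q = (m, Fin.last d) then 1 else 0)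
    + (if p.1 = m ∧ q.1 = m then plusVec d p.2 * (starRingEnd ℂ) (plusVec d q.2) else 0))

/-- The modified lackadaisical quantum walk `Û_lazy = S · (I_N ⊗ C) · Ĝ_or`. -/
def UlazyHat {G : SimpleGraph V} {d : ℕ} (L : Labeling G d) (m : V) (ℓ : ℝ) :
    Matrix (V × Fin (d + 1)) (V × Fin (d + 1)) ℂ :=
  shiftMat L * coinLift d ℓ * oracleHat d m

/-- The action of an automorphism `σ` of `G` on arcs and self-loops:
`P_σ |x, e_i⟩ = |σ x, e_j⟩` with `y_j(σ x) = σ (y_i x)`, and `P_σ |x, ↻⟩ = |σ x, ↻⟩`. -/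
def permFun {G : SimpleGraph V} {d : ℕ} (L : Labeling G d) (σ : G ≃g G)
    (p : V × Fin (d + 1)) : V × Fin (d + 1) :=
  if h : p.2 = Fin.last d then (σ p.1, p.2)
  else
    let i : Fin d := p.2.castPred h
    ⟨σ p.1, Fin.castSucc (L.idx (σ p.1) (σ (L.nbr p.1 i)) (σ.map_adj_iff.mpr (L.adj p.1 i)))⟩

/-- The unitary `P_σ` induced by an automorphism `σ` of `G`, as a matrix. -/
def permMat {G : SimpleGraph V} {d : ℕ} (L : Labeling G d) (σ : G ≃g G) :
    Matrix (V × Fin (d + 1)) (V × Fin (d + 1)) ℂ :=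
  Matrix.of fun p q => if p = permFun L σ q then 1 else 0

/-- `G` is locally arc-transitive if for any vertex `u` with neighbors `v₁, v₂` there is an
automorphism of `G` fixing `u` and mapping `v₁` to `v₂`. -/
def LocallyArcTransitive (G : SimpleGraph V) : Prop :=
  ∀ u v₁ v₂ : V, G.Adj u v₁ → G.Adj u v₂ → ∃ σ : G ≃g G, σ u = u ∧ σ v₁ = v₂

/-- The transition matrix `P` of the simple random walk on a `d`-regular graph. -/
def Pmat (G : SimpleGraph V) [DecidableRel G.Adj] (d : ℕ) : Matrix V V ℝ :=
  Matrix.of fun x y => if G.Adj x y then (1 : ℝ) / d else 0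

/-- The absorbing walk: row `m` is replaced by the unit vector at `m`. -/
def absorb (M : Matrix V V ℝ) (m : V) : Matrix V V ℝ :=
  Matrix.of fun x y => if x = m then (if y = m then 1 else 0) else M x y

/-- The interpolated walk `M(s) = (1−s) M + s M'`. -/
def interp (M : Matrix V V ℝ) (m : V) (s : ℝ) : Matrix V V ℝ :=
  (1 - s) • M + s • absorb M m

/-- The lazy random walk `P̂ = (d/(d+ℓ)) P + (ℓ/(d+ℓ)) I`. -/
def lazyP (G : SimpleGraph V) [DecidableRel G.Adj] (d : ℕ) (ℓ : ℝ) : Matrix V V ℝ :=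
  ((d : ℝ) / (d + ℓ)) • Pmat G d + (ℓ / (d + ℓ)) • (1 : Matrix V V ℝ)

/-- The submatrix `Q` of `P` obtained by deleting the row and column of `m`. -/
def Qsub (P : Matrix V V ℝ) (m : V) :
    Matrix {x : V // x ≠ m} {x : V // x ≠ m} ℝ :=
  Matrix.of fun x y => P x.1 y.1

/-- The hitting time `HT(P, {m}) = Σ_{t≥0} (1/N) Σ_{x≠m, y≠m} (Q^t)_{xy}`. -/
def hittingTime (P : Matrix V V ℝ) (m : V) : ℝ :=
  ∑' t : ℕ, (1 / (Fintype.card V : ℝ)) *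
    ∑ x : {x : V // x ≠ m}, ∑ y : {x : V // x ≠ m}, (Qsub P m ^ t) x y

/-- The state `|x⟩ ⊗ |P(s)_x⟩ = Σ_y √(P(s)_{xy}) |x,y⟩`. -/
def psVec (Ps : Matrix V V ℝ) (x : V) : V × V → ℂ :=
  fun p => if p.1 = x then ((Real.sqrt (Ps x p.2) : ℝ) : ℂ) else 0

/-- The projection `Π_A = Σ_x |x, P(s)_x⟩⟨x, P(s)_x|` onto `span{|x⟩ ⊗ |P(s)_x⟩}`. -/
def projA (Ps : Matrix V V ℝ) : Matrix (V × V) (V × V) ℂ :=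
  Matrix.of fun p q => ∑ x, psVec Ps x p * (starRingEnd ℂ) (psVec Ps x q)

/-- The swap of the two tensor factors of `ℂ^V ⊗ ℂ^V`, as a matrix. -/
def swapMat (V : Type*) [Fintype V] [DecidableEq V] : Matrix (V × V) (V × V) ℂ :=
  Matrix.of fun p q => if p.1 = q.2 ∧ p.2 = q.1 then 1 else 0

/-- Szegedy's quantum walk `W = SWAP · (2Π_A − I)` of a walk with matrix `Ps`. -/
def Wmat (Ps : Matrix V V ℝ) : Matrix (V × V) (V × V) ℂ :=
  swapMat V * ((2 : ℂ) • projA Ps - 1)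

/-- The initial state `|init_ip⟩ = (1/√(N−1)) Σ_{x ≠ m} |x⟩ ⊗ |P(s)_x⟩`. -/
def initIp (Ps : Matrix V V ℝ) (m : V) : V × V → ℂ :=
  fun p => if p.1 = m then 0
    else ((1 / Real.sqrt ((Fintype.card V : ℝ) - 1) : ℝ) : ℂ) * ((Real.sqrt (Ps p.1 p.2) : ℝ) : ℂ)

/-- The discriminant matrix, `D_{xy} = √(M_{xy} M_{yx})`. -/
def discr (M : Matrix V V ℝ) : Matrix V V ℝ :=
  Matrix.of fun x y => Real.sqrt (M x y * M y x)

/-- The unit vector `√π̄ = (1/√(N−1)) Σ_{x ≠ m} |x⟩`. -/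
def sqrtPiBar (m : V) : V → ℝ :=
  fun x => if x = m then 0 else 1 / Real.sqrt ((Fintype.card V : ℝ) - 1)

/-- `(θ, φ)` is an orthonormal eigenbasis of the (unitary) matrix `M`, with
eigenvalues `e^{iθ_k}` and eigenvectors `φ_k`. -/
def IsONEigenbasis {ι : Type*} [Fintype ι] [DecidableEq ι] (M : Matrix ι ι ℂ)
    (θ : ι → ℝ) (φ : ι → (ι → ℂ)) : Prop :=
  (∀ k l, cip (φ k) (φ l) = if k = l then 1 else 0) ∧
  (∀ k, M.mulVec (φ k) = Complex.exp ((θ k : ℂ) * Complex.I) • φ k)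

/-- The squared cotangent quantum hitting time
`QHT(U, w)² = Σ_{e^{iθ_k} ≠ 1} |⟨φ_k|w⟩|² cot²(θ_k/2)` computed in the
orthonormal eigenbasis `(θ, φ)`. -/
def QHTsq {ι : Type*} [Fintype ι] (θ : ι → ℝ) (φ : ι → (ι → ℂ)) (w : ι → ℂ) : ℝ :=
  ∑ k, if Complex.exp ((θ k : ℂ) * Complex.I) = 1 then 0
       else Complex.normSq (cip (φ k) w) * (Real.cos (θ k / 2) / Real.sin (θ k / 2)) ^ 2

/-- `(lam, v)` is a real orthonormal eigenbasis of the symmetric matrix `M`. -/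
def IsRealONEigenbasis (M : Matrix V V ℝ) (lam : V → ℝ) (v : V → (V → ℝ)) : Prop :=
  (∀ k l, (∑ x, v k x * v l x) = if k = l then 1 else 0) ∧
  (∀ k, M.mulVec (v k) = lam k • v k)

/-- The interpolated hitting time `HT⁺ = Σ_{λ_k ≠ 1} |⟨λ_k|√π̄⟩|² / (1 − λ_k)`,
computed in the orthonormal eigenbasis `(lam, v)` of the discriminant. -/
def HTplus (lam : V → ℝ) (v : V → (V → ℝ)) (m : V) : ℝ :=
  ∑ k, if lam k = 1 then 0 else (∑ x, v k x * sqrtPiBar m x) ^ 2 / (1 - lam k)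

/-- The map `E : ℂ^V ⊗ ℂ^V → ℂ^V ⊗ ℂ^{d+1}` with `E|x, y_i(x)⟩ = |x, e_i⟩`,
`E|x,x⟩ = |x,↻⟩` for `x ≠ m`, `E|m,m⟩ = −|m,↻⟩`, and `E|x,y⟩ = 0` otherwise. -/
def Emat {G : SimpleGraph V} [DecidableRel G.Adj] {d : ℕ}
    (L : Labeling G d) (m : V) : Matrix (V × Fin (d + 1)) (V × V) ℂ :=
  Matrix.of fun p q =>
    if h : G.Adj q.1 q.2 then
      (if p = (q.1, Fin.castSucc (L.idx q.1 q.2 h)) then 1 else 0)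
    else if q.2 = q.1 then
      (if p = (q.1, Fin.last d) then (if q.1 = m then -1 else 1) else 0)
    else 0

/-- `SWAP` applied to a vector of `ℂ^V ⊗ ℂ^V`. -/
def swapVecC (v : V × V → ℂ) : V × V → ℂ := fun p => v (p.2, p.1)

/-- The unit vector `|x, Ps_x^⊥⟩` orthogonal to `|x, Ps_x⟩` in
`span{|x, Ps_x⟩, SWAP |x, Ps_x⟩}` (Gram–Schmidt phase convention). -/
def perpVec (Ps : Matrix V V ℝ) (x : V) : V × V → ℂ :=
  fun p =>
    (swapVecC (psVec Ps x) - cip (psVec Ps x) (swapVecC (psVec Ps x)) • psVec Ps x) p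
      / ((l2norm (swapVecC (psVec Ps x) - cip (psVec Ps x) (swapVecC (psVec Ps x)) • psVec Ps x) : ℝ) : ℂ)

/-- The isometry `Σ_x (|x, Ps1_x⟩⟨x, Ps2_x| + |x, Ps1_x^⊥⟩⟨x, Ps2_x^⊥|)`;
`R₁ = Rmat P̂(s) P(s)` and `R₂ = Rmat P(s) P(s)`. -/
def Rmat (Ps1 Ps2 : Matrix V V ℝ) : Matrix (V × V) (V × V) ℂ :=
  Matrix.of fun p q => ∑ x, (psVec Ps1 x p * (starRingEnd ℂ) (psVec Ps2 x q)
    + perpVec Ps1 x p * (starRingEnd ℂ) (perpVec Ps2 x q))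

end LQWPaper

namespace LQWPaper

section

variable {V : Type*} [Fintype V] [DecidableEq V]

lemma IsRealONEigenbasis.sum_coeff_sq {M : Matrix V V ℝ} {lam : V → ℝ} {v : V → V → ℝ}
    (h : IsRealONEigenbasis M lam v) (w : V → ℝ) :
    ∑ k, (∑ x, v k x * w x) ^ 2 = w ⬝ᵥ w := by
  have hA : Matrix.of v * (Matrix.of v).transpose = 1 := by
    ext k l
    simpa [Matrix.mul_apply, Matrix.one_apply] using h.1 k l
  have hw : (Matrix.of v).transpose.mulVec ((Matrix.of v).mulVec w) = w := by
    rw [Matrix.mulVec_mulVec, mul_eq_one_comm.mp hA, Matrix.one_mulVec]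
  calc ∑ k, (∑ x, v k x * w x) ^ 2 = (Matrix.of v).mulVec w ⬝ᵥ (Matrix.of v).mulVec w := by
        simp [dotProduct, Matrix.mulVec, sq]
    _ = w ⬝ᵥ w := by
        rw [Matrix.dotProduct_mulVec, ← Matrix.mulVec_transpose, hw]

lemma IsRealONEigenbasis.sum_eigenvalue_mul_coeff_sq {M : Matrix V V ℝ} {lam : V → ℝ}
    {v : V → V → ℝ} (h : IsRealONEigenbasis M lam v) (w : V → ℝ) :
    ∑ k, lam k * (∑ x, v k x * w x) ^ 2 = w ⬝ᵥ M.mulVec w := by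
  have hA : Matrix.of v * (Matrix.of v).transpose = 1 := by
    ext k l
    simpa [Matrix.mul_apply, Matrix.one_apply] using h.1 k l
  have hw : (Matrix.of v).transpose.mulVec ((Matrix.of v).mulVec w) = w := by
    rw [Matrix.mulVec_mulVec, mul_eq_one_comm.mp hA, Matrix.one_mulVec]
  have hM : M * (Matrix.of v).transpose = (Matrix.of v).transpose * Matrix.diagonal lam := by
    ext x k
    have := congrFun (h.2 k) x
    simpa [Matrix.mul_apply, Matrix.mulVec, dotProduct, Matrix.diagonal_apply, mul_comm] using this
  calc ∑ k, lam k * (∑ x, v k x * w x) ^ 2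
      = (Matrix.of v).mulVec w ⬝ᵥ (Matrix.diagonal lam).mulVec ((Matrix.of v).mulVec w) := by
        simp only [dotProduct, Matrix.mulVec_diagonal]
        refine Finset.sum_congr rfl fun k _ => ?_
        simp only [Matrix.mulVec, dotProduct, Matrix.of_apply]
        ring
    _ = w ⬝ᵥ (M * (Matrix.of v).transpose).mulVec ((Matrix.of v).mulVec w) := by
        rw [hM, ← Matrix.mulVec_mulVec, Matrix.dotProduct_mulVec w, Matrix.vecMul_transpose]
    _ = w ⬝ᵥ M.mulVec w := by
        rw [← Matrix.mulVec_mulVec, hw]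

lemma sqrtPiBar_dotProduct_self (m : V) (hN : 1 < Fintype.card V) :
    sqrtPiBar m ⬝ᵥ sqrtPiBar m = 1 := by
  have hN' : (0 : ℝ) < (Fintype.card V : ℝ) - 1 := by
    have : (1 : ℝ) < Fintype.card V := by exact_mod_cast hN
    linarith
  have hterm : ∀ x, sqrtPiBar m x * sqrtPiBar m x
      = (1 / ((Fintype.card V : ℝ) - 1)) * (1 - if x = m then 1 else 0) := by
    intro x
    unfold sqrtPiBar
    split_ifs
    · simp
    · rw [div_mul_div_comm, Real.mul_self_sqrt hN'.le]; simp
  simp only [dotProduct, hterm, ← Finset.mul_sum, Finset.sum_sub_distrib]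
  simp
  field_simp

lemma sum_Pmat_row {G : SimpleGraph V} [DecidableRel G.Adj] {d : ℕ} (hd : 1 ≤ d)
    (hreg : G.IsRegularOfDegree d) (x : V) : ∑ y, Pmat G d x y = 1 := by
  have hd' : (d : ℝ) ≠ 0 := by positivity
  have hx : ((Finset.univ.filter (G.Adj x)).card : ℝ) = d := by
    rw [← SimpleGraph.neighborFinset_eq_filter, SimpleGraph.card_neighborFinset_eq_degree, hreg x]
  simp only [Pmat, Matrix.of_apply, Finset.sum_ite, Finset.sum_const, nsmul_eq_mul, hx]
  simp [hd']

lemma Pmat_symm (G : SimpleGraph V) [DecidableRel G.Adj] (d : ℕ) (x y : V) :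
    Pmat G d x y = Pmat G d y x := by
  simp [Pmat, G.adj_comm]

lemma sqrtPiBar_dotProduct_discr_interp_mulVec {G : SimpleGraph V} [DecidableRel G.Adj] {d : ℕ}
    (hd : 1 ≤ d) (hreg : G.IsRegularOfDegree d) (m : V) (hN : 1 < Fintype.card V) (s : ℝ) :
    sqrtPiBar m ⬝ᵥ (discr (interp (Pmat G d) m s)).mulVec (sqrtPiBar m)
      = 1 - 1 / ((Fintype.card V : ℝ) - 1) := by
  have hN' : (0 : ℝ) < (Fintype.card V : ℝ) - 1 := by
    have : (1 : ℝ) < Fintype.card V := by exact_mod_cast hN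
    linarith
  have hterm : ∀ x y,
      sqrtPiBar m x * (discr (interp (Pmat G d) m s) x y * sqrtPiBar m y)
        = (1 / ((Fintype.card V : ℝ) - 1)) * ((1 - if x = m then 1 else 0) *
          (Pmat G d x y * (1 - if y = m then 1 else 0))) := by
    intro x y
    by_cases hx : x = m
    · simp [hx, sqrtPiBar]
    by_cases hy : y = m
    · simp [hy, sqrtPiBar]
    have hP : 0 ≤ Pmat G d x y := by
      simp only [Pmat, Matrix.of_apply]
      split_ifs <;> positivity
    have hD : discr (interp (Pmat G d) m s) x y = Pmat G d x y := by
      simp only [discr, interp, absorb, Matrix.of_apply, Matrix.add_apply, Matrix.smul_apply,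
        hx, hy, if_false, smul_eq_mul, Pmat_symm G d y x]
      rw [← add_mul, sub_add_cancel, one_mul, Real.sqrt_mul_self hP]
    rw [hD]
    simp only [sqrtPiBar, hx, hy, if_false]
    calc _ = (1 / (√((Fintype.card V : ℝ) - 1) * √((Fintype.card V : ℝ) - 1))) * Pmat G d x y := by
          field_simp
      _ = _ := by rw [Real.mul_self_sqrt hN'.le]; ring
  have hrow : ∀ x, ∑ y, Pmat G d x y * (1 - if y = m then 1 else 0) = 1 - Pmat G d x m := by
    intro x
    simp [mul_sub, Finset.sum_sub_distrib, sum_Pmat_row hd hreg]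
  have hcol : ∑ x, Pmat G d x m = 1 := by
    simp only [Pmat_symm G d _ m, sum_Pmat_row hd hreg]
  have hmm : Pmat G d m m = 0 := by simp [Pmat]
  simp only [dotProduct, Matrix.mulVec, Finset.mul_sum, hterm]
  simp only [← Finset.mul_sum, hrow]
  simp [sub_mul, Finset.sum_sub_distrib, hcol, hmm]
  field_simp

lemma normSq_exp_mul_I_sub_le (a b : ℝ) :
    Complex.normSq (Complex.exp (a * Complex.I) - Complex.exp (b * Complex.I)) ≤ 4 := by
  rw [Complex.normSq_eq_norm_sq]
  have h := norm_sub_le (Complex.exp (a * Complex.I)) (Complex.exp (b * Complex.I))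
  rw [Complex.norm_exp_ofReal_mul_I, Complex.norm_exp_ofReal_mul_I] at h
  nlinarith [norm_nonneg (Complex.exp (a * Complex.I) - Complex.exp (b * Complex.I))]

end

theorem statement_13 {V : Type*} [Fintype V] [DecidableEq V]
    (G : SimpleGraph V) [DecidableRel G.Adj] (d : ℕ) (m : V)
    (hd : 1 ≤ d) (hN : 3 ≤ Fintype.card V) (hconn : G.Connected)
    (hreg : G.IsRegularOfDegree d)
    (N s : ℝ) (hNdef : N = Fintype.card V) (hs : s = 1 - 1 / N)
    (lam : V → ℝ) (v : V → (V → ℝ))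
    (hlv : IsRealONEigenbasis (discr (interp (Pmat G d) m s)) lam v)
    (α : V → ℝ) (hα : ∀ k, α k = ∑ x, v k x * sqrtPiBar m x)
    (θ : V → ℝ) (hθmem : ∀ k, θ k ∈ Set.Icc 0 Real.pi)
    (hθcos : ∀ k, lam k = Real.cos (θ k))
    (θhat : V → ℝ)
    (hθhat : ∀ k, θhat k = Real.arccos ((N * Real.cos (θ k) + 1) / (N + 1)))
    (θ₀ : ℝ) (hθ₀ : 0 < θ₀) (hθ₀' : θ₀ ≤ Real.pi / 2) (t : ℕ) :
    Real.sqrt (∑ k, if θ₀ < θ k ∧ θ k ≤ Real.pi then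
        α k ^ 2 * Complex.normSq (Complex.exp ((t : ℂ) * (θ k : ℂ) * Complex.I)
          - Complex.exp ((t : ℂ) * (θhat k : ℂ) * Complex.I)) else 0)
      ≤ 2 / Real.sqrt ((1 - Real.cos θ₀) * (N - 1)) := by
  have hN1 : 1 < Fintype.card V := by omega
  have hNpos : 0 < N - 1 := by
    have : (1 : ℝ) < Fintype.card V := by exact_mod_cast hN1
    linarith
  have hc : 0 < 1 - Real.cos θ₀ := by
    have := Real.cos_lt_cos_of_nonneg_of_le_pi_div_two le_rfl hθ₀' hθ₀
    rw [Real.cos_zero] at this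
    linarith
  have hsum : ∑ k, (1 - Real.cos (θ k)) * α k ^ 2 = 1 / (N - 1) := by
    simp only [sub_mul, one_mul, Finset.sum_sub_distrib, ← hθcos, hα]
    rw [hlv.sum_coeff_sq, hlv.sum_eigenvalue_mul_coeff_sq, sqrtPiBar_dotProduct_self m hN1,
      sqrtPiBar_dotProduct_discr_interp_mulVec hd hreg m hN1, hNdef]
    ring
  have hle : (∑ k, if θ₀ < θ k ∧ θ k ≤ Real.pi then
        α k ^ 2 * Complex.normSq (Complex.exp ((t : ℂ) * (θ k : ℂ) * Complex.I)
          - Complex.exp ((t : ℂ) * (θhat k : ℂ) * Complex.I)) else 0)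
      ≤ 4 / (1 - Real.cos θ₀) * (1 / (N - 1)) := by
    rw [← hsum, Finset.mul_sum]
    refine Finset.sum_le_sum fun k _ => ?_
    have hk : 0 ≤ 1 - Real.cos (θ k) := by linarith [Real.cos_le_one (θ k)]
    split_ifs with h
    · have h4 : Complex.normSq (Complex.exp ((t : ℂ) * (θ k : ℂ) * Complex.I)
          - Complex.exp ((t : ℂ) * (θhat k : ℂ) * Complex.I)) ≤ 4 := by
        have := normSq_exp_mul_I_sub_le (t * θ k) (t * θhat k)
        push_cast at this
        exact this
      have hcos : Real.cos (θ k) ≤ Real.cos θ₀ :=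
        Real.cos_le_cos_of_nonneg_of_le_pi hθ₀.le h.2 h.1.le
      have hratio : 1 ≤ (1 - Real.cos (θ k)) / (1 - Real.cos θ₀) := by
        rw [le_div_iff₀ hc]
        linarith
      calc _ ≤ α k ^ 2 * 4 := mul_le_mul_of_nonneg_left h4 (sq_nonneg _)
        _ ≤ α k ^ 2 * 4 * ((1 - Real.cos (θ k)) / (1 - Real.cos θ₀)) :=
            le_mul_of_one_le_right (by positivity) hratio
        _ = _ := by ring
    · positivity
  refine (Real.sqrt_le_sqrt hle).trans_eq ?_
  rw [div_mul_div_comm, mul_one, Real.sqrt_div (by norm_num),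
    show (4 : ℝ) = 2 ^ 2 by norm_num, Real.sqrt_sq (by norm_num)]

end LQWPaper
end
end

section
/- With s = 1 − 1/N, for every threshold angle θ₀ with 0 < θ₀ ≤ π/2, the spectral weight of the initial distribution on eigenvalues of the discriminant below cos θ₀ satisfies Σ_{k : λ_k < cos θ₀} α_k² ≤ 1/((1 − cos θ₀)·(N − 1)). -/
open scoped BigOperators ComplexConjugate
open Complex

set_option linter.unusedSectionVars false

noncomputable section

namespace LQWPaper

lemma sum_mulVec_mul_mulVec {V : Type*} [Fintype V] [DecidableEq V] {M : Matrix V V ℝ}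
    (hM : ∀ k l, (∑ x, M k x * M l x) = if k = l then 1 else 0) (a b : V → ℝ) :
    ∑ k, M.mulVec a k * M.mulVec b k = ∑ x, a x * b x := by
  have h1 : M * M.transpose = 1 := by
    ext k l
    simpa [Matrix.mul_apply, Matrix.one_apply] using hM k l
  have h2 : M.transpose * M = 1 := mul_eq_one_comm.mp h1
  change M.mulVec a ⬝ᵥ M.mulVec b = a ⬝ᵥ b
  rw [Matrix.dotProduct_mulVec, ← Matrix.mulVec_transpose, Matrix.mulVec_mulVec, h2,
    Matrix.one_mulVec]

/-- The weighted spectral sum of an orthonormal eigenbasis is the quadratic form. -/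
lemma sum_eigenvalue_mul_sq {V : Type*} [Fintype V] [DecidableEq V] {D : Matrix V V ℝ}
    {lam : V → ℝ} {v : V → (V → ℝ)} (h : IsRealONEigenbasis D lam v) (u : V → ℝ) :
    ∑ k, lam k * (∑ x, v k x * u x) ^ 2 = ∑ x, ∑ y, u x * D x y * u y := by
  have hk : ∀ k, lam k * (∑ x, v k x * u x) = (Matrix.of v).mulVec (Matrix.vecMul u D) k := by
    intro k
    have e : Matrix.vecMul u D ⬝ᵥ v k = lam k * (u ⬝ᵥ v k) := by
      rw [← Matrix.dotProduct_mulVec, h.2 k, dotProduct_smul, smul_eq_mul]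
    calc lam k * (∑ x, v k x * u x) = lam k * (u ⬝ᵥ v k) := by
          simp only [dotProduct, mul_comm]
      _ = Matrix.vecMul u D ⬝ᵥ v k := e.symm
      _ = _ := dotProduct_comm _ _
  calc ∑ k, lam k * (∑ x, v k x * u x) ^ 2
      = ∑ k, (Matrix.of v).mulVec (Matrix.vecMul u D) k * (Matrix.of v).mulVec u k := by
        refine Finset.sum_congr rfl fun k _ => ?_
        rw [← hk k, sq, mul_assoc]
        rfl
    _ = ∑ y, Matrix.vecMul u D y * u y :=
        sum_mulVec_mul_mulVec (M := Matrix.of v) h.1 _ _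
    _ = ∑ x, ∑ y, u x * D x y * u y := by
        simp only [Matrix.vecMul, dotProduct, Finset.sum_mul]
        exact Finset.sum_comm

/-- The eigenvalues of the discriminant of a stochastic matrix are at most `1`. -/
lemma eigenvalue_discr_le_one {V : Type*} [Fintype V] [DecidableEq V] {M : Matrix V V ℝ}
    (hM : ∀ x y, 0 ≤ M x y) (hsum : ∀ x, ∑ y, M x y = 1) {lam : V → ℝ} {v : V → (V → ℝ)}
    (h : IsRealONEigenbasis (discr M) lam v) (k : V) : lam k ≤ 1 := by
  have hn : ∑ x, v k x * v k x = 1 := by simpa using h.1 k k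
  have hq : lam k = ∑ x, ∑ y, v k x * (discr M x y * v k y) := by
    calc lam k = v k ⬝ᵥ (lam k • v k) := by
          rw [dotProduct_smul]
          simp [dotProduct, hn]
      _ = v k ⬝ᵥ (discr M).mulVec (v k) := by rw [h.2 k]
      _ = _ := by simp only [Matrix.mulVec, dotProduct, Finset.mul_sum]
  have hterm : ∀ x y, v k x * (discr M x y * v k y)
      ≤ (M x y * v k x ^ 2 + M y x * v k y ^ 2) / 2 := by
    intro x y
    have e : discr M x y = Real.sqrt (M x y) * Real.sqrt (M y x) := by
      simp [discr, Real.sqrt_mul (hM x y)]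
    rw [e]
    nlinarith [sq_nonneg (Real.sqrt (M x y) * v k x - Real.sqrt (M y x) * v k y),
      Real.sq_sqrt (hM x y), Real.sq_sqrt (hM y x)]
  have hr : ∑ x, ∑ y, M x y * v k x ^ 2 = 1 := by
    simp only [← Finset.sum_mul, hsum, one_mul]
    simpa only [sq] using hn
  have hc : ∑ x, ∑ y, M y x * v k y ^ 2 = 1 := by rw [Finset.sum_comm]; exact hr
  calc lam k ≤ ∑ x, ∑ y, (M x y * v k x ^ 2 + M y x * v k y ^ 2) / 2 :=
        hq.le.trans (Finset.sum_le_sum fun x _ => Finset.sum_le_sum fun y _ => hterm x y)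
    _ = 1 := by
        simp only [← Finset.sum_div, Finset.sum_add_distrib, hr, hc]
        norm_num

lemma Pmat_nonneg {V : Type*} [Fintype V] [DecidableEq V] (G : SimpleGraph V)
    [DecidableRel G.Adj] (d : ℕ) (x y : V) : 0 ≤ Pmat G d x y := by
  simp only [Pmat, Matrix.of_apply]
  split_ifs <;> positivity

lemma Pmat_comm {V : Type*} [Fintype V] [DecidableEq V] (G : SimpleGraph V)
    [DecidableRel G.Adj] (d : ℕ) (x y : V) : Pmat G d x y = Pmat G d y x := by
  simp only [Pmat, Matrix.of_apply, G.adj_comm]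

lemma sum_Pmat {V : Type*} [Fintype V] [DecidableEq V] {G : SimpleGraph V}
    [DecidableRel G.Adj] {d : ℕ} (hd : 1 ≤ d) (hreg : G.IsRegularOfDegree d) (x : V) :
    ∑ y, Pmat G d x y = 1 := by
  have hd0 : (d : ℝ) ≠ 0 := by positivity
  have hdeg : (Finset.univ.filter fun y => G.Adj x y).card = d := by
    rw [← G.neighborFinset_eq_filter, G.card_neighborFinset_eq_degree, hreg x]
  simp only [Pmat, Matrix.of_apply]
  rw [← Finset.sum_filter, Finset.sum_const, hdeg, nsmul_eq_mul, mul_one_div_cancel hd0]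

lemma interp_nonneg {V : Type*} [Fintype V] [DecidableEq V] {M : Matrix V V ℝ}
    (hM : ∀ x y, 0 ≤ M x y) (m : V) {s : ℝ} (h0 : 0 ≤ s) (h1 : s ≤ 1) (x y : V) :
    0 ≤ interp M m s x y := by
  have hA : 0 ≤ absorb M m x y := by
    simp only [absorb, Matrix.of_apply]
    split_ifs
    exacts [zero_le_one, le_rfl, hM x y]
  simp only [interp, Matrix.add_apply, Matrix.smul_apply, smul_eq_mul]
  exact add_nonneg (mul_nonneg (sub_nonneg.mpr h1) (hM x y)) (mul_nonneg h0 hA)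

lemma sum_interp {V : Type*} [Fintype V] [DecidableEq V] {M : Matrix V V ℝ}
    (hsum : ∀ x, ∑ y, M x y = 1) (m : V) (s : ℝ) (x : V) :
    ∑ y, interp M m s x y = 1 := by
  have hA : ∑ y, absorb M m x y = 1 := by
    by_cases hx : x = m <;> simp [absorb, hx, hsum]
  simp only [interp, Matrix.add_apply, Matrix.smul_apply, smul_eq_mul, Finset.sum_add_distrib,
    ← Finset.mul_sum, hA, hsum]
  ring

lemma interp_apply_of_ne {V : Type*} [Fintype V] [DecidableEq V] (M : Matrix V V ℝ)
    {m x : V} (hx : x ≠ m) (s : ℝ) (y : V) : interp M m s x y = M x y := by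
  simp only [interp, absorb, Matrix.add_apply, Matrix.smul_apply, smul_eq_mul, Matrix.of_apply,
    if_neg hx]
  ring

lemma sum_sqrtPiBar_sq {V : Type*} [Fintype V] [DecidableEq V] (m : V)
    (hN : 2 ≤ Fintype.card V) : ∑ x, sqrtPiBar m x * sqrtPiBar m x = 1 := by
  have hN' : (2 : ℝ) ≤ Fintype.card V := by exact_mod_cast hN
  have hpos : (0 : ℝ) < (Fintype.card V : ℝ) - 1 := by linarith
  have e : ∀ x, sqrtPiBar m x * sqrtPiBar m x
      = 1 / ((Fintype.card V : ℝ) - 1) * (1 - if x = m then 1 else 0) := by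
    intro x
    by_cases hx : x = m
    · simp [sqrtPiBar, hx]
    · simp only [sqrtPiBar, if_neg hx, div_mul_div_comm, Real.mul_self_sqrt hpos.le]
      ring
  simp only [e, ← Finset.mul_sum, Finset.sum_sub_distrib]
  simp [hpos.ne']

lemma sqrtPiBar_quadratic_form {V : Type*} [Fintype V] [DecidableEq V] {G : SimpleGraph V}
    [DecidableRel G.Adj] {d : ℕ} (hd : 1 ≤ d) (hreg : G.IsRegularOfDegree d) (m : V) (s : ℝ)
    (hN : 2 ≤ Fintype.card V) :
    ∑ x, ∑ y, sqrtPiBar m x * discr (interp (Pmat G d) m s) x y * sqrtPiBar m y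
      = 1 - 1 / ((Fintype.card V : ℝ) - 1) := by
  have hN' : (2 : ℝ) ≤ Fintype.card V := by exact_mod_cast hN
  have hpos : (0 : ℝ) < (Fintype.card V : ℝ) - 1 := by linarith
  have e : ∀ x y, sqrtPiBar m x * discr (interp (Pmat G d) m s) x y * sqrtPiBar m y
      = 1 / ((Fintype.card V : ℝ) - 1) * (Pmat G d x y - (if x = m then Pmat G d x y else 0)
        - if y = m then Pmat G d x y else 0) := by
    intro x y
    by_cases hx : x = m
    · by_cases hy : y = m
      · simp [sqrtPiBar, hx, hy, Pmat]
      · simp [sqrtPiBar, hx, hy]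
    · by_cases hy : y = m
      · simp [sqrtPiBar, hx, hy]
      · have hD : discr (interp (Pmat G d) m s) x y = Pmat G d x y := by
          simp only [discr, Matrix.of_apply, interp_apply_of_ne _ hx, interp_apply_of_ne _ hy]
          rw [Pmat_comm G d y x, Real.sqrt_mul_self (Pmat_nonneg G d x y)]
        rw [hD]
        simp only [sqrtPiBar, if_neg hx, if_neg hy, sub_zero]
        rw [mul_right_comm, div_mul_div_comm, Real.mul_self_sqrt hpos.le, one_mul]
  have hcol : ∑ x, Pmat G d x m = 1 := by
    simp only [Pmat_comm G d _ m, sum_Pmat hd hreg]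
  have hrow : ∑ x, ∑ y, (if x = m then Pmat G d x y else 0) = 1 := by
    rw [Finset.sum_comm]
    simp [sum_Pmat hd hreg]
  simp only [e, ← Finset.mul_sum, Finset.sum_sub_distrib, hrow, sum_Pmat hd hreg]
  simp only [Finset.sum_ite_eq', Finset.mem_univ, if_true, hcol, Finset.sum_const,
    Finset.card_univ, nsmul_eq_mul, mul_one]
  field_simp

theorem statement_14 {V : Type*} [Fintype V] [DecidableEq V]
    (G : SimpleGraph V) [DecidableRel G.Adj] (d : ℕ) (m : V)
    (hd : 1 ≤ d) (hN : 3 ≤ Fintype.card V) (hconn : G.Connected)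
    (hreg : G.IsRegularOfDegree d)
    (N s : ℝ) (hNdef : N = Fintype.card V) (hs : s = 1 - 1 / N)
    (lam : V → ℝ) (v : V → (V → ℝ))
    (hlv : IsRealONEigenbasis (discr (interp (Pmat G d) m s)) lam v)
    (α : V → ℝ) (hα : ∀ k, α k = ∑ x, v k x * sqrtPiBar m x)
    (θ₀ : ℝ) (hθ₀ : 0 < θ₀) (hθ₀' : θ₀ ≤ Real.pi / 2) :
    (∑ k, if lam k < Real.cos θ₀ then α k ^ 2 else 0)
      ≤ 1 / ((1 - Real.cos θ₀) * (N - 1)) := by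
  have hN3 : (3 : ℝ) ≤ N := by rw [hNdef]; exact_mod_cast hN
  have hinv : 1 / N ≤ 1 := by rw [div_le_one (by linarith)]; linarith
  have hinv0 : 0 ≤ 1 / N := by positivity
  have hcos : 0 < 1 - Real.cos θ₀ := by
    have := Real.cos_lt_cos_of_nonneg_of_le_pi_div_two le_rfl hθ₀' hθ₀
    rw [Real.cos_zero] at this
    linarith
  have hle : ∀ k, lam k ≤ 1 := eigenvalue_discr_le_one
    (interp_nonneg (Pmat_nonneg G d) m (by linarith) (by linarith))
    (sum_interp (sum_Pmat hd hreg) m s) hlv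
  have hnorm : ∑ k, α k ^ 2 = 1 := by
    rw [← sum_sqrtPiBar_sq m (by lia), ← sum_mulVec_mul_mulVec (M := Matrix.of v) hlv.1]
    refine Finset.sum_congr rfl fun k _ => ?_
    rw [hα k, sq]
    rfl
  have hquad : ∑ k, lam k * α k ^ 2 = 1 - 1 / (N - 1) := by
    rw [hNdef, ← sqrtPiBar_quadratic_form hd hreg m s (by lia), ← sum_eigenvalue_mul_sq hlv]
    simp only [hα]
  have hgap : ∑ k, (1 - lam k) * α k ^ 2 = 1 / (N - 1) := by
    simp only [sub_mul, one_mul, Finset.sum_sub_distrib, hnorm, hquad]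
    ring
  rw [mul_comm, ← div_div, le_div_iff₀ hcos, ← hgap, Finset.sum_mul]
  refine Finset.sum_le_sum fun k _ => ?_
  split_ifs with hk
  · rw [mul_comm]
    exact mul_le_mul_of_nonneg_right (by linarith) (sq_nonneg _)
  · rw [zero_mul]
    exact mul_nonneg (sub_nonneg.mpr (hle k)) (sq_nonneg _)

end LQWPaper
end
end

section
/- Let G be a finite simple graph that is locally arc-transitive: for every vertex w and all neighbors v₁, v₂ of w there exists an automorphism σ of G with σ(w) = w and σ(v₁) = v₂. Then for any two vertices u and v joined by a walk of even length in G there exists an automorphism of G mapping u to v; in particular, any two vertices of G joined by a walk of even length have the same degree. -/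
open scoped BigOperators ComplexConjugate
open Complex

set_option linter.unusedSectionVars false

noncomputable section

namespace LQWPaper

theorem LocallyArcTransitive.exists_iso_of_even_length {V : Type*} {G : SimpleGraph V}
    [Fintype V] [DecidableEq V] (hlat : LocallyArcTransitive G) {u v : V} :
    ∀ p : G.Walk u v, Even p.length → ∃ σ : G ≃g G, σ u = v
  | .nil, _ => ⟨RelIso.refl _, rfl⟩
  | .cons _ .nil, h => by simp at h
  | .cons (v := b) h₁ (.cons (v := c) h₂ q), h => by
    obtain ⟨τ, hτ⟩ := hlat.exists_iso_of_even_length q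
      (by simpa [Nat.even_add_one] using h)
    obtain ⟨σ, -, hσ⟩ := hlat b u c h₁.symm h₂
    exact ⟨σ.trans τ, by simp [hσ, hτ]⟩
  termination_by p => p.length

theorem statement_19 {V : Type*} [Fintype V] [DecidableEq V]
    (G : SimpleGraph V) [DecidableRel G.Adj]
    (hlat : LocallyArcTransitive G) :
    ∀ u v : V, ∀ p : G.Walk u v, Even p.length →
      (∃ σ : G ≃g G, σ u = v) ∧ G.degree u = G.degree v := by
  intro u v p hp
  obtain ⟨σ, rfl⟩ := hlat.exists_iso_of_even_length p hp
  exact ⟨⟨σ, rfl⟩, (σ.degree_eq u).symm⟩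

end LQWPaper
end
end
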